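/- arXiv:1902.10743 — 4 statements merged into one kernel-verified Lean document; each statement's English description precedes it below -/
import Mathlib

section
/- Let r ∈ (0,1) and let B be a real-valued random variable with a density that is positive and symmetric on ℝ and E[B²] < ∞. Then the equation (1+r)/(2r) = E[max(B/μ, 1)] has a unique solution μ in (0, ∞). -/
open MeasureTheory ProbabilityTheory Filter Set

/-- A measure with an even density with respect to Lebesgue measure gives the same mass to both
open half-lines. No measurability of the density is needed. -/
lemma withDensity_Iio_zero_eq_Ioi_zero {g : ℝ → ENNReal} (hg : ∀ x, g (-x) = g x) :
    (volume : Measure ℝ).withDensity g (Iio 0) = (volume : Measure ℝ).withDensity g (Ioi 0) := by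
  rw [withDensity_apply _ measurableSet_Iio, withDensity_apply _ measurableSet_Ioi,
    ← lintegral_indicator measurableSet_Iio, ← lintegral_indicator measurableSet_Ioi,
    ← lintegral_neg_eq_self]
  refine lintegral_congr fun x => ?_
  simp [indicator, hg]

/-- A random variable whose law has an even density is positive with positive probability. -/
lemma measure_pos_of_map_eq_withDensity_even {Ω : Type*} [MeasurableSpace Ω] {P : Measure Ω}
    [IsProbabilityMeasure P] {B : Ω → ℝ} (hB : Measurable B) {g : ℝ → ENNReal}
    (hg : ∀ x, g (-x) = g x) (hlaw : Measure.map B P = volume.withDensity g) :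
    0 < P {ω | 0 < B ω} := by
  have hprob : IsProbabilityMeasure (Measure.map B P) :=
    Measure.isProbabilityMeasure_map hB.aemeasurable
  have hpre : P {ω | 0 < B ω} = Measure.map B P (Ioi 0) :=
    (Measure.map_apply hB measurableSet_Ioi).symm
  rw [hpre, pos_iff_ne_zero]
  intro hpos
  have hneg : Measure.map B P (Iio 0) = 0 := by
    rw [hlaw, withDensity_Iio_zero_eq_Ioi_zero hg, ← hlaw, hpos]
  have hzero : Measure.map B P {0} = 0 := by
    rw [hlaw]
    exact withDensity_absolutelyContinuous _ _ Real.volume_singleton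
  have huniv : Measure.map B P univ = 0 := by
    have hcover : (univ : Set ℝ) = (Iio 0 ∪ {0}) ∪ Ioi 0 := by
      rw [Iio_union_right, Iic_union_Ioi]
    rw [hcover]
    exact measure_union_null (measure_union_null hneg hzero) hpos
  simp at huniv

section ExpectedMax

variable {Ω : Type*} [MeasurableSpace Ω] {P : Measure Ω} [IsProbabilityMeasure P] {B : Ω → ℝ}

lemma integrable_mul_max_one (hB : Integrable B P) (t : ℝ) :
    Integrable (fun ω => max (t * B ω) 1) P :=
  (hB.const_mul t).sup (integrable_const 1)

lemma continuous_integral_mul_max_one (hB : Integrable B P) :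
    Continuous fun t : ℝ => ∫ ω, max (t * B ω) 1 ∂P := by
  refine (LipschitzWith.of_dist_le_mul (K := (∫ ω, |B ω| ∂P).toNNReal) fun s t => ?_).continuous
  rw [Real.coe_toNNReal _ (integral_nonneg fun ω => abs_nonneg _), Real.dist_eq, Real.dist_eq,
    ← integral_sub (integrable_mul_max_one hB s) (integrable_mul_max_one hB t),
    ← integral_mul_const]
  refine abs_integral_le_integral_abs.trans
    (integral_mono ((integrable_mul_max_one hB s).sub (integrable_mul_max_one hB t)).abs
      (hB.abs.mul_const _) fun ω => ?_)
  refine (abs_max_sub_max_le_abs _ _ _).trans_eq ?_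
  rw [← sub_mul, abs_mul, mul_comm]

/-- Convexity of `t ↦ E[max (t B) 1]`, along the segment from `0` to `t`. -/
lemma integral_mul_max_one_le (hB : Integrable B P) {a : ℝ} (ha0 : 0 ≤ a) (ha1 : a ≤ 1) (t : ℝ) :
    ∫ ω, max (a * t * B ω) 1 ∂P ≤ (1 - a) + a * ∫ ω, max (t * B ω) 1 ∂P := by
  have hint := integrable_mul_max_one hB t
  calc ∫ ω, max (a * t * B ω) 1 ∂P
      ≤ ∫ ω, ((1 - a) + a * max (t * B ω) 1) ∂P := by
        refine integral_mono (integrable_mul_max_one hB _)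
          ((integrable_const _).add (hint.const_mul a)) fun ω => max_le ?_ ?_
        · nlinarith [mul_le_mul_of_nonneg_left (le_max_left (t * B ω) 1) ha0]
        · nlinarith [mul_le_mul_of_nonneg_left (le_max_right (t * B ω) 1) ha0]
    _ = (1 - a) + a * ∫ ω, max (t * B ω) 1 ∂P := by
        rw [integral_add (integrable_const _) (hint.const_mul a), integral_const_mul]
        simp

lemma integral_mul_max_one_lt {s t : ℝ} (hB : Integrable B P) (hs : 0 ≤ s) (hst : s < t)
    (ht : 1 < ∫ ω, max (t * B ω) 1 ∂P) :
    ∫ ω, max (s * B ω) 1 ∂P < ∫ ω, max (t * B ω) 1 ∂P := by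
  have ht0 : 0 < t := hs.trans_lt hst
  have ha1 : s / t < 1 := (div_lt_one ht0).2 hst
  have hle := integral_mul_max_one_le hB (div_nonneg hs ht0.le) ha1.le t
  rw [div_mul_cancel₀ _ ht0.ne'] at hle
  nlinarith

lemma exists_integral_mul_max_one_eq (hB : Integrable B P) (hpos : 0 < P {ω | 0 < B ω}) {c : ℝ}
    (hc : 1 < c) : ∃ t : ℝ, 0 < t ∧ ∫ ω, max (t * B ω) 1 ∂P = c := by
  have hint : Integrable (fun ω => max (B ω) 0) P := hB.pos_part
  have hmean : 0 < ∫ ω, max (B ω) 0 ∂P := by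
    refine (integral_pos_iff_support_of_nonneg (f := fun ω => max (B ω) 0)
      (fun ω => le_max_right _ _) hint).2 ?_
    refine hpos.trans_le (measure_mono fun ω hω => ?_)
    exact (lt_max_of_lt_left hω).ne'
  set m := ∫ ω, max (B ω) 0 ∂P
  have hT : 0 < c / m := by positivity
  have hlarge : c ≤ ∫ ω, max (c / m * B ω) 1 ∂P := by
    calc c = ∫ ω, c / m * max (B ω) 0 ∂P := by
          rw [integral_const_mul, div_mul_cancel₀ _ hmean.ne']
      _ ≤ _ := by
          refine integral_mono (hint.const_mul _) (integrable_mul_max_one hB _) fun ω => ?_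
          dsimp only
          rw [mul_max_of_nonneg _ _ hT.le, mul_zero]
          exact max_le_max_left _ zero_le_one
  have hzero : ∫ ω, max (0 * B ω) 1 ∂P = 1 := by simp
  obtain ⟨t, ht, hct⟩ := intermediate_value_Icc hT.le
    (continuous_integral_mul_max_one hB).continuousOn ⟨hzero.trans_le hc.le, hlarge⟩
  refine ⟨t, ht.1.lt_of_ne ?_, hct⟩
  rintro rfl
  exact hc.ne (hzero.symm.trans hct)

lemma existsUnique_integral_div_max_one_eq (hB : Integrable B P) (hpos : 0 < P {ω | 0 < B ω})
    {c : ℝ} (hc : 1 < c) : ∃! μ : ℝ, 0 < μ ∧ c = ∫ ω, max (B ω / μ) 1 ∂P := by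
  simp only [div_eq_inv_mul]
  obtain ⟨t, ht, hct⟩ := exists_integral_mul_max_one_eq hB hpos hc
  refine ⟨t⁻¹, ⟨inv_pos.2 ht, by rw [inv_inv, hct]⟩, fun μ ⟨hμ, hcμ⟩ => ?_⟩
  rw [← inv_eq_iff_eq_inv]
  rcases lt_trichotomy μ⁻¹ t with h | h | h
  · have := integral_mul_max_one_lt hB (inv_pos.2 hμ).le h (hc.trans_eq hct.symm)
    linarith
  · exact h
  · have := integral_mul_max_one_lt hB ht.le h (hc.trans_eq hcμ)
    linarith

end ExpectedMax

/-- Let `r ∈ (0,1)` and let `B` be a real-valued random variable with a density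
that is positive and symmetric on `ℝ` and `E[B²] < ∞`. Then the equation
`(1+r)/(2r) = E[max (B/μ) 1]` has a unique solution `μ` in `(0, ∞)`. -/
theorem statement_1 {Ω : Type*} [MeasurableSpace Ω] (P : Measure Ω) [IsProbabilityMeasure P]
    (r : ℝ) (hr : r ∈ Set.Ioo (0 : ℝ) 1)
    (B : Ω → ℝ) (hBmeas : Measurable B)
    (f : ℝ → ℝ) (hf_pos : ∀ x, 0 < f x) (hf_symm : ∀ x, f (-x) = f x)
    (hlaw : Measure.map B P = (volume : Measure ℝ).withDensity (fun x => ENNReal.ofReal (f x)))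
    (hBsq : Integrable (fun ω => (B ω) ^ 2) P) :
    ∃! μ : ℝ, 0 < μ ∧ (1 + r) / (2 * r) = ∫ ω, max (B ω / μ) 1 ∂P := by
  have hB : Integrable B P :=
    ((memLp_two_iff_integrable_sq hBmeas.aestronglyMeasurable).2 hBsq).integrable one_le_two
  refine existsUnique_integral_div_max_one_eq hB
    (measure_pos_of_map_eq_withDensity_even hBmeas (fun x => by rw [hf_symm]) hlaw) ?_
  rw [lt_div_iff₀ (by linarith [hr.1])]
  linarith [hr.2]
end

section
/- Let B be a real-valued random variable with a density that is positive and symmetric on ℝ and E[B²] < ∞. For r ∈ (0,1) let μ(r) denote the unique positive solution of (1+r)/(2r) = E[max(B/μ, 1)]. Then μ is strictly increasing in r: if 0 < r₁ < r₂ < 1 then μ(r₁) < μ(r₂). In particular, the bid-ask spread 2μ(r) is a strictly increasing function of r. -/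
open MeasureTheory ProbabilityTheory Filter Set

/-- Capping `b / m` from below at `1` is antitone in the scale `m > 0`. -/
theorem max_div_one_le_max_div_one {b m n : ℝ} (hm : 0 < m) (hmn : m ≤ n) :
    max (b / n) 1 ≤ max (b / m) 1 := by
  rcases le_total 0 b with hb | hb
  · exact max_le_max_right _ (div_le_div_of_nonneg_left hb hm hmn)
  · have h : b / n ≤ 0 := div_nonpos_of_nonpos_of_nonneg hb (hm.le.trans hmn)
    exact max_le ((h.trans zero_le_one).trans (le_max_right _ _)) (le_max_right _ _)

/-- The map `r ↦ (1 + r) / (2 * r)` is strictly decreasing on the positive reals. -/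
theorem strictAntiOn_one_add_div_two_mul :
    StrictAntiOn (fun r : ℝ => (1 + r) / (2 * r)) (Set.Ioi 0) := by
  intro r hr s hs hrs
  simp only [Set.mem_Ioi] at hr hs
  change (1 + s) / (2 * s) < (1 + r) / (2 * r)
  rw [div_lt_div_iff₀ (by positivity) (by positivity)]
  linarith

/-- Let `B` be a real-valued random variable with a density that is positive and
symmetric on `ℝ` and `E[B²] < ∞`. For `r ∈ (0,1)` let `μ r` denote the unique positive solution
of `(1+r)/(2r) = E[max (B/μ) 1]`. Then `μ` is strictly increasing in `r`; in particular, the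
bid-ask spread `2 μ r` is a strictly increasing function of `r`. -/
theorem statement_2 {Ω : Type*} [MeasurableSpace Ω] (P : Measure Ω) [IsProbabilityMeasure P]
    (B : Ω → ℝ) (hBmeas : Measurable B)
    (f : ℝ → ℝ) (hf_pos : ∀ x, 0 < f x) (hf_symm : ∀ x, f (-x) = f x)
    (hlaw : Measure.map B P = (volume : Measure ℝ).withDensity (fun x => ENNReal.ofReal (f x)))
    (hBsq : Integrable (fun ω => (B ω) ^ 2) P)
    (μ : ℝ → ℝ)
    (hμ : ∀ r ∈ Set.Ioo (0 : ℝ) 1,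
      0 < μ r ∧ (1 + r) / (2 * r) = ∫ ω, max (B ω / μ r) 1 ∂P) :
    StrictMonoOn μ (Set.Ioo (0 : ℝ) 1) ∧
    StrictMonoOn (fun r => 2 * μ r) (Set.Ioo (0 : ℝ) 1) := by
  have hB : Integrable B P :=
    ((memLp_two_iff_integrable_sq hBmeas.aestronglyMeasurable).2 hBsq).integrable one_le_two
  have hint (m : ℝ) : Integrable (fun ω => max (B ω / m) 1) P :=
    (hB.div_const m).sup (integrable_const 1)
  have hmono : StrictMonoOn μ (Set.Ioo (0 : ℝ) 1) := by
    intro r hr s hs hrs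
    by_contra! hle
    have hexp : ∫ ω, max (B ω / μ r) 1 ∂P ≤ ∫ ω, max (B ω / μ s) 1 ∂P :=
      integral_mono (hint _) (hint _) fun _ => max_div_one_le_max_div_one (hμ s hs).1 hle
    rw [← (hμ r hr).2, ← (hμ s hs).2] at hexp
    exact hexp.not_gt (strictAntiOn_one_add_div_two_mul hr.1 hs.1 hrs)
  exact ⟨hmono, fun r hr s hs hrs => mul_lt_mul_of_pos_left (hmono hr hs hrs) two_pos⟩
end

section
/- Let r ∈ (0,1), let B be a real-valued random variable with a density positive and symmetric on ℝ and E[B²] < ∞, and let μ > 0 satisfy (1+r)/(2r) = E[max(B/μ, 1)]. Then 1 − r·P[|B| ≤ μ] = (r/μ)·E[|B|·1_{|B| > μ}], and consequently the variance per trade satisfies σ_tr² = r·E[B²] / (1 − r·P[|B| ≤ μ]) = E[B²]·μ / E[|B|·1_{|B| > μ}]. -/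
open MeasureTheory ProbabilityTheory Filter Set

/-- A measure with an even density with respect to Lebesgue measure is invariant under negation. -/
lemma map_neg_withDensity_of_even {g : ℝ → ENNReal} (hg : ∀ x, g (-x) = g x) :
    Measure.map (fun x => -x) ((volume : Measure ℝ).withDensity g) = volume.withDensity g := by
  ext s hs
  rw [Measure.map_apply measurable_neg hs, withDensity_apply _ (measurable_neg hs),
    withDensity_apply _ hs,
    ← (Measure.measurePreserving_neg (volume : Measure ℝ)).setLIntegral_comp_preimage_emb
      (MeasurableEquiv.neg ℝ).measurableEmbedding g s]
  exact lintegral_congr fun x => (hg x).symm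

lemma max_div_one_add_max_neg_div_one {μ : ℝ} (hμ : 0 < μ) (b : ℝ) :
    max (b / μ) 1 + max (-b / μ) 1 = 1 + max (|b| / μ) 1 := by
  rcases le_total 0 b with h | h
  · have h' : -b / μ ≤ 1 := (div_nonpos_of_nonpos_of_nonneg (by linarith) hμ.le).trans zero_le_one
    rw [abs_of_nonneg h, max_eq_right h', add_comm]
  · have h' : b / μ ≤ 1 := (div_nonpos_of_nonpos_of_nonneg h hμ.le).trans zero_le_one
    rw [abs_of_nonpos h, max_eq_right h']

/-- Splitting the expectation of `max (|B| / μ) 1` according to whether `|B|` exceeds `μ`. -/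
lemma integral_max_abs_div_one {Ω : Type*} [MeasurableSpace Ω] {P : Measure Ω}
    [IsProbabilityMeasure P] {B : Ω → ℝ} (hBmeas : Measurable B) (hB : Integrable B P)
    {μ : ℝ} (hμ : 0 < μ) :
    ∫ ω, max (|B ω| / μ) 1 ∂P
      = (P {ω | |B ω| ≤ μ}).toReal + (∫ ω in {ω | μ < |B ω|}, |B ω| ∂P) / μ := by
  have hs : MeasurableSet {ω | |B ω| ≤ μ} := measurableSet_le hBmeas.abs measurable_const
  have hc : {ω | |B ω| ≤ μ}ᶜ = {ω | μ < |B ω|} := by ext; simp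
  have hint : Integrable (fun ω => max (|B ω| / μ) 1) P :=
    (hB.abs.div_const μ).sup (integrable_const 1)
  rw [← integral_add_compl hs hint, setIntegral_congr_fun (g := fun _ => (1 : ℝ)) hs
      fun ω hω => max_eq_right ((div_le_one hμ).2 hω),
    setIntegral_congr_fun (g := fun ω => |B ω| / μ) hs.compl
      fun ω hω => max_eq_left ((one_le_div hμ).2 (le_of_not_ge hω)),
    integral_div, hc]
  simp [Measure.real]

/-- Let `r ∈ (0,1)`, `B` a random variable with a density positive and
symmetric on `ℝ` and `E[B²] < ∞`, and `μ > 0` satisfying `(1+r)/(2r) = E[max (B/μ) 1]`. Then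
`1 − r·P[|B| ≤ μ] = (r/μ)·E[|B|·1_{|B| > μ}]`, and consequently the variance per trade satisfies
`σ_tr² = r·E[B²] / (1 − r·P[|B| ≤ μ]) = E[B²]·μ / E[|B|·1_{|B| > μ}]`. -/
theorem statement_12 {Ω : Type*} [MeasurableSpace Ω] (P : Measure Ω) [IsProbabilityMeasure P]
    (r : ℝ) (hr : r ∈ Set.Ioo (0 : ℝ) 1)
    (B : Ω → ℝ) (hBmeas : Measurable B)
    (f : ℝ → ℝ) (hf_pos : ∀ x, 0 < f x) (hf_symm : ∀ x, f (-x) = f x)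
    (hlaw : Measure.map B P = (volume : Measure ℝ).withDensity (fun x => ENNReal.ofReal (f x)))
    (hBsq : Integrable (fun ω => (B ω) ^ 2) P)
    (μ : ℝ) (hμpos : 0 < μ)
    (hμeq : (1 + r) / (2 * r) = ∫ ω, max (B ω / μ) 1 ∂P) :
    1 - r * (P {ω | |B ω| ≤ μ}).toReal = (r / μ) * ∫ ω in {ω | μ < |B ω|}, |B ω| ∂P ∧
    r * (∫ ω, (B ω) ^ 2 ∂P) / (1 - r * (P {ω | |B ω| ≤ μ}).toReal)
      = (∫ ω, (B ω) ^ 2 ∂P) * μ / ∫ ω in {ω | μ < |B ω|}, |B ω| ∂P := by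
  have hB : Integrable B P :=
    ((memLp_two_iff_integrable_sq hBmeas.aestronglyMeasurable).2 hBsq).integrable one_le_two
  have hsymm : ∫ ω, max (-B ω / μ) 1 ∂P = ∫ ω, max (B ω / μ) 1 ∂P := by
    have hinv : Measure.map (fun x => -x) (Measure.map B P) = Measure.map B P := by
      rw [hlaw]
      exact map_neg_withDensity_of_even fun x => by rw [hf_symm]
    have hφ : Continuous fun x : ℝ => max (x / μ) 1 := by fun_prop
    rw [← integral_map hBmeas.aemeasurable (f := fun x => max (x / μ) 1)
        hφ.aestronglyMeasurable, ← hinv,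
      integral_map measurable_neg.aemeasurable hφ.aestronglyMeasurable,
      integral_map hBmeas.aemeasurable (f := fun x => max (-x / μ) 1)
        (hφ.comp continuous_neg).aestronglyMeasurable]
  have hmax {X : Ω → ℝ} (hX : Integrable X P) : Integrable (fun ω => max (X ω / μ) 1) P :=
    (hX.div_const μ).sup (integrable_const 1)
  have hsum : (∫ ω, max (B ω / μ) 1 ∂P) + ∫ ω, max (-B ω / μ) 1 ∂P
      = 1 + ∫ ω, max (|B ω| / μ) 1 ∂P := by
    rw [← integral_add (hmax hB) (hmax hB.fun_neg)]
    simp only [max_div_one_add_max_neg_div_one hμpos]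
    rw [integral_add (integrable_const 1) (hmax hB.abs)]
    simp
  rw [hsymm, ← hμeq, integral_max_abs_div_one hBmeas hB hμpos] at hsum
  have hr0 : r ≠ 0 := hr.1.ne'
  have hμ0 : μ ≠ 0 := hμpos.ne'
  have key : 1 - r * (P {ω | |B ω| ≤ μ}).toReal
      = (r / μ) * ∫ ω in {ω | μ < |B ω|}, |B ω| ∂P := by
    field_simp at hsum ⊢
    linarith
  refine ⟨key, ?_⟩
  rw [key]
  field_simp
end

section
/- Let α > 0 and μ ≥ 0. Then ∫₀^α ( ⌈(μ − s)/α⌉ + ⌈(μ + s)/α⌉ ) ds = 2μ + α, where ⌈·⌉ is the usual ceiling function. In other words, if the offset d of the efficient price with respect to the tick grid is uniformly distributed on [0, α], the average bid-ask spread under tick size α equals the intrinsic spread 2μ plus the tick size α: φ_α = 2μ + α. -/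
open MeasureTheory intervalIntegral

theorem monotone_intCast_ceil : Monotone fun x : ℝ => (⌈x⌉ : ℝ) :=
  Int.cast_mono.comp Int.ceil_mono

theorem intervalIntegrable_ceil (a b : ℝ) :
    IntervalIntegrable (fun x : ℝ => (⌈x⌉ : ℝ)) volume a b :=
  monotone_intCast_ceil.intervalIntegrable

theorem integral_ceil_zero_one : ∫ x in (0 : ℝ)..1, (⌈x⌉ : ℝ) = 1 := by
  have h : ∫ x in (0 : ℝ)..1, (⌈x⌉ : ℝ) = ∫ _ in (0 : ℝ)..1, (1 : ℝ) := by
    refine integral_congr_ae (Filter.Eventually.of_forall fun x hx => ?_)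
    rw [Set.uIoc_of_le zero_le_one] at hx
    have : ⌈x⌉ = 1 := Int.ceil_eq_iff.2 ⟨by simpa using hx.1, by simpa using hx.2⟩
    simp [this]
  simp [h]

theorem periodic_ceil_sub_self : Function.Periodic (fun x : ℝ => (⌈x⌉ : ℝ) - x) 1 := by
  intro x
  simp

theorem integral_ceil_add_one (t : ℝ) : ∫ x in t..t + 1, (⌈x⌉ : ℝ) = t + 1 := by
  have h := periodic_ceil_sub_self.intervalIntegral_add_eq t 0
  rw [zero_add, integral_sub (intervalIntegrable_ceil _ _) intervalIntegrable_id,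
    integral_sub (intervalIntegrable_ceil _ _) intervalIntegrable_id, integral_ceil_zero_one,
    integral_id, integral_id] at h
  linarith

/-- Let `α > 0` and `μ ≥ 0`. Then
`∫₀^α (⌈(μ − s)/α⌉ + ⌈(μ + s)/α⌉) ds = 2μ + α`: if the offset of the efficient price with respect
to the tick grid is uniformly distributed on `[0, α]`, the average bid-ask spread under tick size
`α` equals the intrinsic spread `2μ` plus the tick size `α`. -/
theorem statement_15 (α μ : ℝ) (hα : 0 < α) (hμ : 0 ≤ μ) :
    ∫ s in (0 : ℝ)..α, ((⌈(μ - s) / α⌉ : ℝ) + (⌈(μ + s) / α⌉ : ℝ)) = 2 * μ + α := by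
  have hanti : Antitone fun s : ℝ => (⌈(μ - s) / α⌉ : ℝ) := fun a b hab =>
    monotone_intCast_ceil (by gcongr)
  have hmono : Monotone fun s : ℝ => (⌈(μ + s) / α⌉ : ℝ) := fun a b hab =>
    monotone_intCast_ceil (by gcongr)
  have hα' : α ≠ 0 := hα.ne'
  have hsub : ∫ s in (0 : ℝ)..α, (⌈(μ - s) / α⌉ : ℝ) = μ := by
    have h := integral_comp_sub_div (a := 0) (b := α) (fun x : ℝ => (⌈x⌉ : ℝ)) hα' (μ / α)
    have h1 := integral_ceil_add_one (μ / α - 1)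
    rw [sub_add_cancel] at h1
    simp only [← sub_div, div_self hα', zero_div, sub_zero] at h
    rw [h, h1, smul_eq_mul, mul_div_cancel₀ _ hα']
  have hadd : ∫ s in (0 : ℝ)..α, (⌈(μ + s) / α⌉ : ℝ) = μ + α := by
    have h := integral_comp_add_div (a := 0) (b := α) (fun x : ℝ => (⌈x⌉ : ℝ)) hα' (μ / α)
    simp only [← add_div, add_zero] at h
    rw [h, add_div, div_self hα', integral_ceil_add_one, smul_eq_mul]
    field_simp
  rw [integral_add hanti.intervalIntegrable hmono.intervalIntegrable, hsub, hadd]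
  ring
end
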